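/- Lemma 2.3, identity (2.7): For any integers 1 ≤ k < n and 1 ≤ a_1 < a_2 < ... < a_k ≤ n, the number of lozenge tilings of the quartered hexagon L_{2k−1,n}(a_1,...,a_k) equals (1 / H2(2k)) · ∏_{1≤i<j≤k} (a_j−a_i) · ∏_{1≤i<j≤k} (a_i+a_j−1). -/

import Mathlib

open Finset

/-- A unit triangle of the triangular lattice, in sheared coordinates:
`(true, a, j)` is the up-pointing triangle with horizontal base
`[a + j/2, a + 1 + j/2]` on the lattice line at height `j`;
`(false, a, j)` is the down-pointing triangle with apex `(a + 1 + j/2, j)`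
and top edge on the lattice line at height `j + 1`. -/
abbrev Tri : Type := Bool × ℤ × ℤ

def upT (a j : ℤ) : Tri := (true, a, j)
def dnT (a j : ℤ) : Tri := (false, a, j)

/-- A lozenge (union of two unit triangles sharing an edge), recorded by the
coordinates of its up-pointing triangle (first component) and of its
down-pointing triangle (second component). -/
abbrev Loz : Type := (ℤ × ℤ) × (ℤ × ℤ)

/-- The two triangles of a lozenge share an edge: the down-pointing triangle is
the right, left or lower neighbour of the up-pointing one. -/
def lozAdj (l : Loz) : Prop :=
  l.2 = l.1 ∨ l.2 = (l.1.1 - 1, l.1.2) ∨ l.2 = (l.1.1, l.1.2 - 1)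

/-- `T` is a lozenge tiling of the region `R`: it consists of lozenges lying in
`R` and covers every unit triangle of `R` exactly once. -/
def IsTiling (R : Finset Tri) (T : Finset Loz) : Prop :=
  (∀ l ∈ T, lozAdj l ∧ upT l.1.1 l.1.2 ∈ R ∧ dnT l.2.1 l.2.2 ∈ R) ∧
  (∀ t ∈ R, ∃! l, l ∈ T ∧ (t = upT l.1.1 l.1.2 ∨ t = dnT l.2.1 l.2.2))

/-- All lozenge tilings of `R` avoiding the forbidden lozenges in `F`
(the barriers), collected in a finset. -/
noncomputable def tilings (R : Finset Tri) (F : Finset Loz) : Finset (Finset Loz) := by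
  classical
  exact ((R.image Prod.snd ×ˢ R.image Prod.snd).powerset).filter
    (fun T => IsTiling R T ∧ ∀ l ∈ T, l ∉ F)

/-- `Mtil R F` : the number of lozenge tilings of `R` avoiding the barriers `F`. -/
noncomputable def Mtil (R : Finset Tri) (F : Finset Loz) : ℕ := (tilings R F).card

/-- Weighted tiling number: each lozenge in `Wt` carries weight `1/2`, all other
lozenges weight `1`; a tiling is weighted by the product of its lozenge weights. -/
noncomputable def Mw (R : Finset Tri) (F : Finset Loz) (Wt : Finset Loz) : ℚ :=
  ∑ T ∈ tilings R F, (1 / 2 : ℚ) ^ (T ∩ Wt).card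

/-- Reflection of a unit triangle over the horizontal lattice line `l` (height `0`). -/
def reflTri (t : Tri) : Tri :=
  if t.1 then (false, t.2.1 + t.2.2, -t.2.2 - 1) else (true, t.2.1 + t.2.2 + 1, -t.2.2 - 1)

/-- Reflection of a lozenge over the horizontal lattice line `l` (height `0`). -/
def reflLoz (l : Loz) : Loz :=
  ((l.2.1 + l.2.2 + 1, -l.2.2 - 1), (l.1.1 + l.1.2, -l.1.2 - 1))

/-- The up-pointing unit triangles removed at the positions of `U`
(1-indexed, from left to right) just above the line `l`. -/
def upDents (U : Finset ℕ) : Finset Tri := U.image (fun (i : ℕ) => upT ((i : ℤ) - 1) 0)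

/-- The down-pointing unit triangles removed at the positions of `D`
(1-indexed, from left to right) just below the line `l`. -/
def dnDents (D : Finset ℕ) : Finset Tri := D.image (fun (i : ℕ) => dnT ((i : ℤ) - 1) (-1))

/-- The vertical lozenges straddling the line `l` at the barrier positions `B`:
these are forbidden in any tiling. -/
def barrierLoz (B : Finset ℕ) : Finset Loz :=
  B.image (fun (i : ℕ) => (((i : ℤ) - 1, 0), ((i : ℤ) - 1, -1)))

/-- The upper half of a hexagon: the semihexagon (trapezoid) with base `W` on the
line `l` and `h` rows of unit triangles above it. -/
def upperHex (W h : ℕ) : Finset Tri :=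
  (Finset.range h).biUnion fun j =>
    ((Finset.range (W - j)).image fun (a : ℕ) => upT (a : ℤ) (j : ℤ)) ∪
    ((Finset.range (W - j - 1)).image fun (a : ℕ) => dnT (a : ℤ) (j : ℤ))

/-- The doubly-dented hexagon `H_{x,y}(U; D)` (with `n = |U ∪ D|` recorded
explicitly): the hexagon of side lengths `x+n-u, y+u, y+d, x+n-d, y+d, y+u`
(clockwise from the north side) with the up-pointing unit triangles at the
positions of `U` and the down-pointing unit triangles at the positions of `D`
removed along the horizontal axis `l` through its west and east vertices. -/
def Hreg (x y n : ℕ) (U D : Finset ℕ) : Finset Tri :=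
  (upperHex (x + y + n) (y + U.card) \ upDents U) ∪
  ((upperHex (x + y + n) (y + D.card)).image reflTri \ dnDents D)

/-- The quartered hexagon `L_{m,n}(A)`: the trapezoid whose northern,
northeastern, southern sides have lengths `n`, `m`, `n + ⌊(m+1)/2⌋` and whose
western side is a vertical zigzag of `m` steps, with the up-pointing unit
triangles at the positions of `A` removed from the base. -/
def Lreg (m n : ℕ) (A : Finset ℕ) : Finset Tri :=
  ((Finset.range m).biUnion fun j =>
    ((Finset.range (n + (m + 1) / 2 + j / 2 - j)).image
        fun (a : ℕ) => upT ((a : ℤ) - ((j / 2 : ℕ) : ℤ)) (j : ℤ)) ∪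
    ((Finset.range (n + (m + 1) / 2 + (j + 1) / 2 - (j + 1))).image
        fun (a : ℕ) => dnT ((a : ℤ) - (((j + 1) / 2 : ℕ) : ℤ)) (j : ℤ)))
  \ upDents A

/-- The vertical lozenges sitting along (the bumps of) the western zigzag side
of the quartered hexagon `L_{m,n}`; these get weight `1/2` in `L̄_{m,n}`. -/
def westLoz (m : ℕ) : Finset Loz :=
  ((Finset.range m).filter fun j => j % 2 = 1).image fun j =>
    ((-(((j - 1) / 2 : ℕ) : ℤ), (j : ℤ)), (-(((j - 1) / 2 : ℕ) : ℤ), (j : ℤ) - 1))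

/-- The doubly-dented halved hexagon `F_{x,y}(U; D)`: north, northeast,
southeast, south sides of lengths `x+n-u, 2y+2u, 2y+2d, x+n-d`, western side a
vertical zigzag with `4y+2u+2d` steps, with up-dents `U` and down-dents `D`
along the horizontal line `l` through the east vertex. -/
def Freg (x y n : ℕ) (U D : Finset ℕ) : Finset Tri :=
  Lreg (2 * y + 2 * U.card) (x + n - U.card) U ∪
  (Lreg (2 * y + 2 * D.card) (x + n - D.card) D).image reflTri

/-- The doubly-dented halved hexagon `F̄_{x,y}(U; D)`: side lengths
`x+n-u, 2y-1+2u, 2y-1+2d, x+n-d` and a western zigzag with `4y+2u+2d-2` steps,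
with up-dents `U` and down-dents `D` along the line `l` through the east vertex. -/
def Fbar (x y n : ℕ) (U D : Finset ℕ) : Finset Tri :=
  Lreg (2 * y + 2 * U.card - 1) (x + n - U.card) U ∪
  (Lreg (2 * y + 2 * D.card - 1) (x + n - D.card) D).image reflTri

/-- The weight-`1/2` vertical lozenges on the western side of `W_{x,y}(U;D;B)`
(where `u = |U|`, `d = |D|`). -/
def wtW (y u d : ℕ) : Finset Loz :=
  westLoz (2 * y + 2 * u) ∪ (westLoz (2 * y + 2 * d)).image reflLoz

/-- The weight-`1/2` vertical lozenges on the western side of `W̄_{x,y}(U;D;B)`. -/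
def wtWbar (y u d : ℕ) : Finset Loz :=
  westLoz (2 * y + 2 * u - 1) ∪ (westLoz (2 * y + 2 * d - 1)).image reflLoz

/-- `m - S = {m - s : s ∈ S}`. -/
def mirrorSet (m : ℕ) (S : Finset ℕ) : Finset ℕ := S.image fun i => m - i

/-- The reflectively symmetric doubly-dented hexagon
`RS_{x,y}(U;D) = H_{x,y}(U ∪ ((x+y+2n+1)-U); D ∪ ((x+y+2n+1)-D))`. -/
def RSreg (x y n : ℕ) (U D : Finset ℕ) : Finset Tri :=
  Hreg x y (2 * n) (U ∪ mirrorSet (x + y + 2 * n + 1) U)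
    (D ∪ mirrorSet (x + y + 2 * n + 1) D)

/-- Reflection of a lozenge over the vertical symmetry axis of a region whose
base on the line `l` spans the horizontal interval `[0, W]`. -/
def vreflLoz (W : ℤ) (l : Loz) : Loz :=
  ((W - 1 - l.1.1 - l.1.2, l.1.2), (W - 2 - l.2.1 - l.2.2, l.2.2))

/-- The number of lozenge tilings of `R` (avoiding the barriers `F`) invariant
under the reflection over the vertical axis of a base of width `W`. -/
noncomputable def Msym (R : Finset Tri) (F : Finset Loz) (W : ℤ) : ℕ := by
  classical
  exact ((tilings R F).filter fun T => T.image (vreflLoz W) = T).card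

/-- `M_r(RS_{x,y}(U;D;B))` : the number of reflectively symmetric lozenge
tilings of the symmetric doubly-dented hexagon with barriers at
`B ∪ ((x+y+2n+1)-B)`. -/
noncomputable def Mr (x y n : ℕ) (U D B : Finset ℕ) : ℕ :=
  Msym (RSreg x y n U D)
    (barrierLoz (B ∪ mirrorSet (x + y + 2 * n + 1) B))
    ((x : ℤ) + (y : ℤ) + 2 * (n : ℤ))

/-- The skipping hyperfactorial: `H2 (2k) = 0! 2! ⋯ (2k-2)!` and
`H2 (2k+1) = 1! 3! ⋯ (2k-1)!`. -/
def H2 (n : ℕ) : ℕ :=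
  ∏ j ∈ (Finset.range n).filter (fun j => j % 2 = n % 2), Nat.factorial j

/-- `∏_{1 ≤ i < j ≤ k} (s_j² - s_i²)` for the increasing enumeration
`s_1 < ⋯ < s_k` of `S`. -/
def prodDiffSq (S : Finset ℕ) : ℚ :=
  ∏ p ∈ S, ∏ q ∈ S.filter (fun q => p < q), ((q : ℚ) ^ 2 - (p : ℚ) ^ 2)

/-- `∏_{1 ≤ i < j ≤ k} (s_j - s_i)`. -/
def prodDiff (S : Finset ℕ) : ℚ :=
  ∏ p ∈ S, ∏ q ∈ S.filter (fun q => p < q), ((q : ℚ) - (p : ℚ))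

/-- `∏_{1 ≤ i < j ≤ k} (s_j - s_i)(s_j + s_i - 1)`. -/
def prodDS1 (S : Finset ℕ) : ℚ :=
  ∏ p ∈ S, ∏ q ∈ S.filter (fun q => p < q), (((q : ℚ) - (p : ℚ)) * ((q : ℚ) + (p : ℚ) - 1))

/-- `∏_{1 ≤ i < j ≤ k} (s_j - s_i)(s_j + s_i - 2)`. -/
def prodDS2 (S : Finset ℕ) : ℚ :=
  ∏ p ∈ S, ∏ q ∈ S.filter (fun q => p < q), (((q : ℚ) - (p : ℚ)) * ((q : ℚ) + (p : ℚ) - 2))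

/-- `∏_{1 ≤ i < j ≤ k} (s_i + s_j)`. -/
def prodSum0 (S : Finset ℕ) : ℚ :=
  ∏ p ∈ S, ∏ q ∈ S.filter (fun q => p < q), ((q : ℚ) + (p : ℚ))

/-- `∏_{1 ≤ i < j ≤ k} (s_i + s_j - 1)`. -/
def prodSum1 (S : Finset ℕ) : ℚ :=
  ∏ p ∈ S, ∏ q ∈ S.filter (fun q => p < q), ((q : ℚ) + (p : ℚ) - 1)

/-- `∏_{1 ≤ i < j ≤ k} (s_i + s_j - 2)`. -/
def prodSum2 (S : Finset ℕ) : ℚ :=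
  ∏ p ∈ S, ∏ q ∈ S.filter (fun q => p < q), ((q : ℚ) + (p : ℚ) - 2)

/-- `∏_{1 ≤ i ≤ j ≤ k} (s_i + s_j - 1)` (the diagonal `i = j` included). -/
def prodSumLe1 (S : Finset ℕ) : ℚ :=
  ∏ p ∈ S, ∏ q ∈ S.filter (fun q => p ≤ q), ((q : ℚ) + (p : ℚ) - 1)



theorem mem_tilings_empty {R : Finset Tri} {T : Finset Loz} :
    T ∈ tilings R ∅ ↔ IsTiling R T := by
  unfold tilings
  simp only [mem_filter, mem_powerset, notMem_empty, not_false_eq_true, implies_true, and_true,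
    and_iff_right_iff_imp]
  intro h l hl
  obtain ⟨-, h1, h2⟩ := h.1 l hl
  rw [mem_product]
  exact ⟨mem_image.2 ⟨_, h1, rfl⟩, mem_image.2 ⟨_, h2, rfl⟩⟩

theorem mtil_empty : Mtil ∅ ∅ = 1 := by
  rw [Mtil, card_eq_one]
  refine ⟨∅, ?_⟩
  ext T
  rw [mem_tilings_empty, mem_singleton]
  constructor
  · intro h
    rw [eq_empty_iff_forall_notMem]
    intro l hl
    exact notMem_empty _ (h.1 l hl).2.1
  · rintro rfl
    exact ⟨fun l hl => absurd hl (notMem_empty _), fun t ht => absurd ht (notMem_empty _)⟩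

/-- The region left after placing the lozenge `l`. -/
def removeLoz (R : Finset Tri) (l : Loz) : Finset Tri :=
  R \ {upT l.1.1 l.1.2, dnT l.2.1 l.2.2}

theorem upT_ne_dnT (a j b i : ℤ) : upT a j ≠ dnT b i := by simp [upT, dnT]

theorem IsTiling.erase {R : Finset Tri} {T : Finset Loz} (h : IsTiling R T) {l : Loz}
    (hl : l ∈ T) : IsTiling (removeLoz R l) (T.erase l) := by
  obtain ⟨h1, h2⟩ := h
  have hu := h1 l hl
  refine ⟨fun l' hl' => ?_, fun t ht => ?_⟩
  · obtain ⟨hne, hl'⟩ := mem_erase.1 hl'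
    have h' := h1 l' hl'
    refine ⟨h'.1, ?_, ?_⟩
    · simp only [removeLoz, mem_sdiff, h'.2.1, mem_insert, mem_singleton, true_and, not_or]
      exact ⟨fun e => hne ((h2 _ h'.2.1).unique ⟨hl', Or.inl rfl⟩ ⟨hl, Or.inl e⟩),
        upT_ne_dnT _ _ _ _⟩
    · simp only [removeLoz, mem_sdiff, h'.2.2, mem_insert, mem_singleton, true_and, not_or]
      exact ⟨(upT_ne_dnT _ _ _ _).symm,
        fun e => hne ((h2 _ h'.2.2).unique ⟨hl', Or.inr rfl⟩ ⟨hl, Or.inr e⟩)⟩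
  · simp only [removeLoz, mem_sdiff, mem_insert, mem_singleton] at ht
    obtain ⟨l', ⟨hl', ht'⟩, huniq⟩ := h2 t ht.1
    refine ⟨l', ⟨mem_erase.2 ⟨?_, hl'⟩, ht'⟩, fun y hy => huniq y ⟨mem_of_mem_erase hy.1, hy.2⟩⟩
    rintro rfl
    exact ht.2 ht'

theorem IsTiling.insert {R : Finset Tri} {T : Finset Loz} {l : Loz} (hl : lozAdj l)
    (hu : upT l.1.1 l.1.2 ∈ R) (hd : dnT l.2.1 l.2.2 ∈ R) (h : IsTiling (removeLoz R l) T) :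
    l ∉ T ∧ IsTiling R (insert l T) := by
  obtain ⟨h1, h2⟩ := h
  simp only [removeLoz, mem_sdiff, mem_insert, mem_singleton] at h1 h2
  refine ⟨fun h => by simpa using (h1 l h).2.1, fun l' hl' => ?_, fun t ht => ?_⟩
  · rcases mem_insert.1 hl' with rfl | hl'
    · exact ⟨hl, hu, hd⟩
    · have := h1 l' hl'
      exact ⟨this.1, this.2.1.1, this.2.2.1⟩
  · by_cases hc : t = upT l.1.1 l.1.2 ∨ t = dnT l.2.1 l.2.2
    · refine ⟨l, ⟨mem_insert_self _ _, hc⟩, fun y hy => ?_⟩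
      rcases mem_insert.1 hy.1 with rfl | hy'
      · rfl
      · have := h1 y hy'
        rcases hy.2 with rfl | rfl
        · exact absurd hc this.2.1.2
        · exact absurd hc this.2.2.2
    · obtain ⟨l', ⟨hl', ht'⟩, huniq⟩ := h2 t ⟨ht, hc⟩
      refine ⟨l', ⟨mem_insert_of_mem hl', ht'⟩, fun y hy => ?_⟩
      rcases mem_insert.1 hy.1 with rfl | hy'
      · exact absurd hy.2 hc
      · exact huniq y ⟨hy', hy.2⟩

/-- The number of tilings of `R` that use the lozenge `l`. -/
noncomputable def mtilWith (R : Finset Tri) (l : Loz) : ℕ :=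
  ((tilings R ∅).filter fun T => l ∈ T).card

theorem mtilWith_eq {R : Finset Tri} {l : Loz} (hl : lozAdj l) :
    mtilWith R l =
      if upT l.1.1 l.1.2 ∈ R ∧ dnT l.2.1 l.2.2 ∈ R then Mtil (removeLoz R l) ∅ else 0 := by
  split_ifs with h
  · refine card_bij' (fun T _ => T.erase l) (fun T _ => insert l T) ?_ ?_ ?_ ?_
    · intro T hT
      rw [mem_filter, mem_tilings_empty] at hT
      exact mem_tilings_empty.2 (hT.1.erase hT.2)
    · intro T hT
      rw [mem_tilings_empty] at hT
      rw [mem_filter, mem_tilings_empty]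
      exact ⟨(hT.insert hl h.1 h.2).2, mem_insert_self _ _⟩
    · intro T hT
      exact insert_erase (mem_filter.1 hT).2
    · intro T hT
      rw [mem_tilings_empty] at hT
      exact erase_insert (hT.insert hl h.1 h.2).1
  · rw [mtilWith, card_eq_zero, filter_eq_empty_iff]
    intro T hT hlT
    rw [mem_tilings_empty] at hT
    exact h (hT.1 l hlT).2

theorem mtil_eq_sum_mtilWith {R : Finset Tri} {t : Tri} (ht : t ∈ R) (L : Finset Loz)
    (hL : ∀ l ∈ L, t = upT l.1.1 l.1.2 ∨ t = dnT l.2.1 l.2.2)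
    (hR : ∀ l, lozAdj l → upT l.1.1 l.1.2 ∈ R → dnT l.2.1 l.2.2 ∈ R →
      (t = upT l.1.1 l.1.2 ∨ t = dnT l.2.1 l.2.2) → l ∈ L) :
    Mtil R ∅ = ∑ l ∈ L, mtilWith R l := by
  classical
  have : tilings R ∅ = L.biUnion fun l => (tilings R ∅).filter fun T => l ∈ T := by
    ext T
    simp only [mem_biUnion, mem_filter]
    constructor
    · intro hT
      have hT' := mem_tilings_empty.1 hT
      obtain ⟨l, ⟨hl, hlt⟩, -⟩ := hT'.2 t ht
      have := hT'.1 l hl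
      exact ⟨l, hR l this.1 this.2.1 this.2.2 hlt, hT, hl⟩
    · rintro ⟨l, -, hT, -⟩
      exact hT
  rw [Mtil, this, card_biUnion]
  · rfl
  · intro l hl l' hl' hne
    rw [Function.onFun, disjoint_left]
    intro T hT hT'
    rw [mem_filter] at hT hT'
    exact hne (((mem_tilings_empty.1 hT.1).2 t ht).unique ⟨hT.2, hL l hl⟩ ⟨hT'.2, hL l' hl'⟩)

theorem mtil_of_up_mem {R : Finset Tri} {a j : ℤ} (h : upT a j ∈ R) (h1 : dnT (a - 1) j ∉ R)
    (h2 : dnT a (j - 1) ∉ R) :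
    Mtil R ∅ = if dnT a j ∈ R then Mtil (R \ {upT a j, dnT a j}) ∅ else 0 := by
  rw [mtil_eq_sum_mtilWith h {((a, j), (a, j))}, sum_singleton, mtilWith_eq (Or.inl rfl)]
  · simp [h, removeLoz]
  · simp
  · rintro ⟨⟨a', j'⟩, ⟨b', i'⟩⟩ hadj hu hd ht
    simp only [lozAdj, upT, dnT, Prod.mk.injEq, mem_singleton] at *
    rcases ht with ht | ht
    · obtain ⟨-, rfl, rfl⟩ := ht
      rcases hadj with ⟨rfl, rfl⟩ | ⟨rfl, rfl⟩ | ⟨rfl, rfl⟩ <;> simp_all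
    · simp at ht

theorem mtil_of_dn_mem {R : Finset Tri} {a j : ℤ} (h : dnT a j ∈ R) (h1 : upT a j ∉ R) :
    Mtil R ∅ = (if upT (a + 1) j ∈ R then Mtil (R \ {upT (a + 1) j, dnT a j}) ∅ else 0) +
      if upT a (j + 1) ∈ R then Mtil (R \ {upT a (j + 1), dnT a j}) ∅ else 0 := by
  rw [mtil_eq_sum_mtilWith h {((a + 1, j), (a, j)), ((a, j + 1), (a, j))}, sum_pair (by simp),
    mtilWith_eq, mtilWith_eq]
  · simp [h, removeLoz]
  · simp [lozAdj]
  · simp [lozAdj]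
  · simp
  · rintro ⟨⟨a', j'⟩, ⟨b', i'⟩⟩ hadj hu hd ht
    simp only [lozAdj, upT, dnT, Prod.mk.injEq, mem_singleton, mem_insert] at *
    rcases ht with ht | ht
    · simp at ht
    · obtain ⟨-, rfl, rfl⟩ := ht
      rcases hadj with ⟨rfl, rfl⟩ | ⟨rfl, rfl⟩ | ⟨rfl, rfl⟩ <;> simp_all

@[simp]
theorem upT_eq_upT {a j b i : ℤ} : upT a j = upT b i ↔ a = b ∧ j = i := by simp [upT]

@[simp]
theorem dnT_eq_dnT {a j b i : ℤ} : dnT a j = dnT b i ↔ a = b ∧ j = i := by simp [dnT]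

@[simp]
theorem upT_eq_dnT {a j b i : ℤ} : upT a j = dnT b i ↔ False := by simp [upT, dnT]

@[simp]
theorem dnT_eq_upT {a j b i : ℤ} : dnT a j = upT b i ↔ False := by simp [upT, dnT]

theorem tri_ext {R S : Finset Tri} (hu : ∀ a j, upT a j ∈ R ↔ upT a j ∈ S)
    (hd : ∀ a j, dnT a j ∈ R ↔ dnT a j ∈ S) : R = S := by
  ext ⟨c, a, j⟩
  cases c
  · exact hd a j
  · exact hu a j

/-- The part of the row `j` between the up-pointing triangles `a` and `E` (both included), with the
up-pointing triangles at the positions of `A` removed. -/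
noncomputable def upStrip (j a E : ℤ) (A : Finset ℤ) : Finset Tri :=
  ((Icc a E \ A).image fun b => upT b j) ∪ ((Ico a E).image fun b => dnT b j)

/-- The part of the row `j` between the down-pointing triangle `a` and the up-pointing triangle `E`
(both included), with the up-pointing triangles at the positions of `A` removed. -/
noncomputable def dnStrip (j a E : ℤ) (A : Finset ℤ) : Finset Tri :=
  ((Ioc a E \ A).image fun b => upT b j) ∪ ((Ico a E).image fun b => dnT b j)

section Strip

variable {j a b i E : ℤ} {A : Finset ℤ} {R : Finset Tri}

@[simp]
theorem upT_mem_upStrip : upT b i ∈ upStrip j a E A ↔ i = j ∧ a ≤ b ∧ b ≤ E ∧ b ∉ A := by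
  simp [upStrip]; grind

@[simp]
theorem dnT_mem_upStrip : dnT b i ∈ upStrip j a E A ↔ i = j ∧ a ≤ b ∧ b < E := by
  simp [upStrip]; grind

@[simp]
theorem upT_mem_dnStrip : upT b i ∈ dnStrip j a E A ↔ i = j ∧ a < b ∧ b ≤ E ∧ b ∉ A := by
  simp [dnStrip]; grind

@[simp]
theorem dnT_mem_dnStrip : dnT b i ∈ dnStrip j a E A ↔ i = j ∧ a ≤ b ∧ b < E := by
  simp [dnStrip]; grind

/-- All triangles of `R` lie in rows above the row `j`. -/
def IsAbove (j : ℤ) (R : Finset Tri) : Prop := ∀ t ∈ R, j < t.2.2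

theorem IsAbove.up (hR : IsAbove j R) (h : upT b i ∈ R) : j < i := hR _ h

theorem IsAbove.dn (hR : IsAbove j R) (h : dnT b i ∈ R) : j < i := hR _ h

theorem IsAbove.sdiff (hR : IsAbove j R) (S : Finset Tri) : IsAbove j (R \ S) :=
  fun t ht => hR t (mem_sdiff.1 ht).1

theorem upStrip_eq_dnStrip (h : a ∈ A) : upStrip j a E A = dnStrip j a E A := by
  apply tri_ext <;> intro b i
  · simp only [upT_mem_upStrip, upT_mem_dnStrip]
    grind
  · simp

theorem mtil_upStrip_step (hR : IsAbove j R) (hA : a ∉ A) (haE : a < E) :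
    Mtil (upStrip j a E A ∪ R) ∅ = Mtil (upStrip j (a + 1) E A ∪ R) ∅ := by
  have hu := fun b i => hR.up (b := b) (i := i)
  have hd := fun b i => hR.dn (b := b) (i := i)
  rw [mtil_of_up_mem (a := a) (j := j), if_pos]
  · congr 1
    apply tri_ext <;> intro b i
    · have := hu b i
      simp
      grind
    · have := hd b i
      simp
      grind
  · simp; grind
  · simp; grind
  · have := hd (a - 1) j
    simp; grind
  · have := hd a (j - 1)
    simp; grind

theorem mtil_upStrip_skip (hR : IsAbove j R) (hab : a ≤ b) (hbE : b ≤ E)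
    (hA : ∀ c ∈ Ico a b, c ∉ A) :
    Mtil (upStrip j a E A ∪ R) ∅ = Mtil (upStrip j b E A ∪ R) ∅ := by
  induction b, hab using Int.leInduction with
  | base => rfl
  | succ b hab ih =>
    rw [ih (by lia) fun c hc => hA c (by simp at hc ⊢; lia), mtil_upStrip_step hR _ (by lia)]
    exact hA b (by simp; lia)

theorem mtil_upStrip_eq_zero (hR : IsAbove j R) (haE : a ≤ E) (hA : ∀ c ∈ Icc a E, c ∉ A) :
    Mtil (upStrip j a E A ∪ R) ∅ = 0 := by
  have hd := fun b i => hR.dn (b := b) (i := i)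
  rw [mtil_upStrip_skip hR haE le_rfl fun c hc => hA c (by simp at hc ⊢; lia),
    mtil_of_up_mem (a := E) (j := j), if_neg]
  · have := hd E j
    simp; grind
  · have := hA E (by simp; lia)
    simp; grind
  · have := hd (E - 1) j
    simp; grind
  · have := hd E (j - 1)
    simp; grind

theorem mtil_dnStrip_step (hR : IsAbove j R) (haE : a < E) :
    Mtil (dnStrip j a E A ∪ R) ∅ =
      (if a + 1 ∈ A then 0 else Mtil (dnStrip j (a + 1) E A ∪ R) ∅) +
      if upT a (j + 1) ∈ R then Mtil (upStrip j (a + 1) E A ∪ (R \ {upT a (j + 1)})) ∅ else 0 := by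
  have hu := fun b i => hR.up (b := b) (i := i)
  have hd := fun b i => hR.dn (b := b) (i := i)
  have h1 := hu (a + 1) j
  rw [mtil_of_dn_mem (a := a) (j := j)]
  · congr 1
    · by_cases h : a + 1 ∈ A
      · rw [if_pos h, if_neg]
        simp; grind
      · rw [if_neg h, if_pos]
        · congr 1
          apply tri_ext <;> intro b i
          · have := hu b i
            simp
            grind
          · have := hd b i
            simp
            grind
        · simp; grind
    · by_cases h : upT a (j + 1) ∈ R
      · rw [if_pos h, if_pos (mem_union_right _ h)]
        congr 1
        apply tri_ext <;> intro b i
        · have := hu b i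
          simp
          grind
        · have := hd b i
          simp
          grind
      · rw [if_neg h, if_neg]
        simp; grind
  · simp; grind
  · have := hu a j
    simp; grind

theorem mtil_dnStrip_last {a : ℤ} (hR : IsAbove j R) (hA : ∀ c ∈ Ioc a E, c ∉ A) :
    Mtil (dnStrip j a E A ∪ R) ∅ = Mtil R ∅ := by
  obtain haE | haE := le_or_gt E a
  · congr 1
    apply tri_ext <;> intro b i <;> simp <;> lia
  · rw [mtil_dnStrip_step hR haE, if_neg (hA _ (by simp; lia)),
      mtil_dnStrip_last hR fun c hc => hA c (by simp at hc ⊢; lia),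
      mtil_upStrip_eq_zero (hR.sdiff _) (by lia) fun c hc => hA c (by simp at hc ⊢; lia)]
    simp
termination_by (E - a).toNat

theorem mtil_dnStrip_next {a : ℤ} (hR : IsAbove j R) (hab : a < b) (hbE : b ≤ E) (hb : b ∈ A)
    (hA : ∀ c ∈ Ioo a b, c ∉ A) :
    Mtil (dnStrip j a E A ∪ R) ∅ = ∑ w ∈ Ico a b,
      if upT w (j + 1) ∈ R then Mtil (dnStrip j b E A ∪ (R \ {upT w (j + 1)})) ∅ else 0 := by
  have hI : Ico a b = insert a (Ico (a + 1) b) := by ext; simp; lia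
  have hskip : ∀ S, Mtil (upStrip j (a + 1) E A ∪ (R \ S)) ∅ =
      Mtil (dnStrip j b E A ∪ (R \ S)) ∅ := fun S => by
    rw [mtil_upStrip_skip (hR.sdiff _) (b := b) (by lia) hbE
      fun c hc => hA c (by simp at hc ⊢; lia), upStrip_eq_dnStrip hb]
  rw [mtil_dnStrip_step hR (by lia), hI, sum_insert (by simp), hskip, add_comm]
  congr 1
  obtain rfl | hne := eq_or_ne (a + 1) b
  · simp [hb]
  · rw [if_neg (hA _ (by simp; lia)), mtil_dnStrip_next hR (by lia) hbE hb
      fun c hc => hA c (by simp at hc ⊢; lia)]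
termination_by (b - a).toNat

theorem sum_piFinset_succ {r : ℕ} {M : Type*} [AddCommMonoid M] (s : Fin (r + 1) → Finset ℤ)
    (g : (Fin (r + 1) → ℤ) → M) :
    ∑ w ∈ Fintype.piFinset s, g w =
      ∑ c ∈ s 0, ∑ w ∈ Fintype.piFinset (fun i : Fin r => s i.succ), g (Fin.cons c w) := by
  rw [← sum_product']
  refine sum_bij' (fun w _ => (w 0, Fin.tail w)) (fun p _ => Fin.cons p.1 p.2) ?_ ?_ ?_ ?_ ?_
  · simp +contextual [Fintype.mem_piFinset, Fin.tail]
  · simp +contextual [Fintype.mem_piFinset, Fin.forall_fin_succ]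
  · simp
  · simp
  · simp

/-- Peeling off a row whose removed triangles are `x 0 < x 1 < ⋯ < x r`. -/
theorem mtil_dnStrip_eq_sum {r : ℕ} {x : Fin (r + 1) → ℤ} {R : Finset Tri} (hR : IsAbove j R)
    (hx : StrictMono x) (hE : ∀ i : Fin r, x i.succ ≤ E) :
    Mtil (dnStrip j (x 0) E (univ.image x) ∪ R) ∅ =
      ∑ w ∈ Fintype.piFinset fun i : Fin r => Ico (x i.castSucc) (x i.succ),
        if ∀ i, upT (w i) (j + 1) ∈ R
          then Mtil (R \ univ.image fun i => upT (w i) (j + 1)) ∅ else 0 := by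
  induction r generalizing R with
  | zero =>
    rw [mtil_dnStrip_last hR]
    · simp [Fintype.piFinset_of_isEmpty]
    · simp
      lia
  | succ r ih =>
    have h01 : x 0 < x 1 := hx (by simp)
    rw [mtil_dnStrip_next (b := x 1) hR h01 (hE 0) (by simp)]
    · rw [sum_piFinset_succ]
      refine sum_congr rfl fun c hc => ?_
      have hc1 : c < x 1 := (mem_Ico.1 hc).2
      have hstrip : dnStrip j (x 1) E (univ.image x) =
          dnStrip j (x 1) E (univ.image fun i : Fin (r + 1) => x i.succ) := by
        apply tri_ext <;> intro b i
        · simp only [upT_mem_dnStrip, mem_image, mem_univ, true_and, Fin.exists_fin_succ]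
          grind
        · simp
      have hxs : StrictMono fun i : Fin (r + 1) => x i.succ :=
        hx.comp (Fin.strictMono_succ)
      have key := ih (hR.sdiff {upT c (j + 1)}) hxs fun i => hE i.succ
      simp only [Fin.succ_zero_eq_one, Fin.succ_castSucc] at key ⊢
      rw [hstrip, key]
      by_cases hcR : upT c (j + 1) ∈ R
      · rw [if_pos hcR]
        refine sum_congr rfl fun w hw => ?_
        have hne : ∀ i, w i ≠ c := fun i => by
          have h1 := mem_Ico.1 (Fintype.mem_piFinset.1 hw i)
          have h2 : x 1 ≤ x i.castSucc.succ := hx.monotone (by simp [Fin.le_def])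
          simp only [Fin.succ_castSucc] at h2
          lia
        simp only [Fin.forall_fin_succ, Fin.cons_zero, Fin.cons_succ, mem_sdiff, mem_singleton,
          upT_eq_upT, hne, not_false_eq_true, and_true, hcR, true_and]
        congr 2
        ext t
        simp only [mem_sdiff, mem_image, mem_univ, true_and, Fin.exists_fin_succ, mem_singleton,
          Fin.cons_zero, Fin.cons_succ]
        grind
      · simp [hcR, Fin.forall_fin_succ]
    · simp
      intro c hc hc' i
      rintro rfl
      have h0 := Fin.lt_def.1 (hx.lt_iff_lt.1 hc)
      have h1 := Fin.lt_def.1 (hx.lt_iff_lt.1 hc')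
      simp at h0 h1
      lia

end Strip


theorem sum_det_interlacing {r : ℕ} (f F : ℕ → ℤ → ℤ)
    (hF : ∀ t a b, a ≤ b → ∑ u ∈ Ico a b, f t u = F t b - F t a)
    {x : Fin (r + 1) → ℤ} (hx : StrictMono x) :
    ∑ w ∈ Fintype.piFinset fun i : Fin r => Ico (x i.castSucc) (x i.succ),
        (Matrix.of fun i t : Fin r => f t (w i)).det =
      (Matrix.of fun i : Fin (r + 1) =>
        (Fin.cons 1 fun t : Fin r => F t (x i) : Fin (r + 1) → ℤ)).det := by
  have h := (Matrix.detRowAlternating (n := Fin r) (R := ℤ)).toMultilinearMap.map_sum_finset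
    (fun _ u t => f t u) (fun i : Fin r => Ico (x i.castSucc) (x i.succ))
  refine h.symm.trans ?_
  rw [Matrix.det_eq_of_forall_row_eq_smul_add_pred (fun _ => 1) (B := Matrix.of (Fin.cons
    (Fin.cons 1 fun t : Fin r => F t (x 0)) fun i : Fin r =>
      (Fin.cons 0 fun t : Fin r => F t (x i.succ) - F t (x i.castSucc) : Fin (r + 1) → ℤ))),
    Matrix.det_succ_column_zero, Fin.sum_univ_succ]
  · simp only [Matrix.of_apply, Fin.cons_zero, Fin.cons_succ, Fin.coe_ofNat_eq_mod, Nat.zero_mod,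
      pow_zero, one_mul, mul_zero, zero_mul, sum_const_zero, add_zero]
    refine congrArg Matrix.det (Matrix.ext fun i t => ?_)
    simp [hF, hx.monotone (Fin.castSucc_le_succ i)]
  · intro t
    simp
  · intro i t
    refine Fin.cases ?_ (fun t => ?_) t <;> simp

theorem sum_Ico_choose (c : ℤ) (m : ℕ) {a b : ℤ} (hab : a ≤ b) :
    ∑ u ∈ Ico a b, Ring.choose (u + c) m =
      Ring.choose (b + c) (m + 1) - Ring.choose (a + c) (m + 1) := by
  induction b, hab using Int.leInduction with
  | base => simp
  | succ b hab ih =>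
    have hI : Ico a (b + 1) = insert b (Ico a b) := by ext; simp; lia
    rw [hI, sum_insert (by simp), ih, add_right_comm b 1 c, Ring.choose_succ_succ]
    ring

/-- The rows `j, …, m - 1` of a quartered hexagon with a base of length `N`. -/
noncomputable def upperRows (N m j : ℕ) : Finset Tri :=
  (Ico j m).biUnion fun i =>
    (Ico (-(i / 2 : ℤ)) (N - i)).image (fun a => upT a i) ∪
    (Ico (-((i + 1) / 2 : ℤ)) (N - i - 1)).image fun a => dnT a i

theorem upT_mem_upperRows {N m j : ℕ} {a i : ℤ} :
    upT a i ∈ upperRows N m j ↔ j ≤ i ∧ i < m ∧ -(i / 2) ≤ a ∧ a < N - i := by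
  simp only [upperRows, mem_biUnion, mem_union, mem_image, mem_Ico, upT_eq_upT, dnT_eq_upT,
    and_false, exists_false, or_false]
  constructor
  · rintro ⟨i, hi, a, ha, rfl, rfl⟩
    lia
  · intro h
    exact ⟨i.toNat, by lia, a, by lia, rfl, by lia⟩

theorem dnT_mem_upperRows {N m j : ℕ} {a i : ℤ} :
    dnT a i ∈ upperRows N m j ↔ j ≤ i ∧ i < m ∧ -((i + 1) / 2) ≤ a ∧ a < N - i - 1 := by
  simp only [upperRows, mem_biUnion, mem_union, mem_image, mem_Ico, dnT_eq_dnT, upT_eq_dnT,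
    and_false, exists_false, false_or]
  constructor
  · rintro ⟨i, hi, a, ha, rfl, rfl⟩
    lia
  · intro h
    exact ⟨i.toNat, by lia, a, by lia, rfl, by lia⟩

theorem isAbove_upperRows (N m j : ℕ) : IsAbove j (upperRows N m (j + 1)) := by
  rintro ⟨c, a, i⟩ h
  cases c
  · have := (dnT_mem_upperRows.1 h).1
    simp; lia
  · have := (upT_mem_upperRows.1 h).1
    simp; lia

/-- The rows `j, …, m - 1` of a quartered hexagon with a base of length `N`, with the up-pointing
triangles at the positions `s i` removed from the row `j`. -/
noncomputable def dentedRows (N m j : ℕ) {r : ℕ} (s : Fin r → ℤ) : Finset Tri :=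
  upperRows N m j \ univ.image fun i => upT (s i) j

theorem mtil_dentedRows_of_eq (N m : ℕ) (s : Fin 0 → ℤ) : Mtil (dentedRows N m m s) ∅ = 1 := by
  simp [dentedRows, upperRows, mtil_empty]

theorem lreg_eq_upperRows (m n : ℕ) (A : Finset ℕ) (hm : m < 2 * n) :
    Lreg m n A = upperRows (n + (m + 1) / 2) m 0 \ upDents A := by
  unfold Lreg
  congr 1
  apply tri_ext <;> intro a i
  · rw [upT_mem_upperRows]
    simp only [mem_biUnion, mem_union, mem_image, mem_range, upT_eq_upT, dnT_eq_upT,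
      and_false, exists_false, or_false]
    constructor
    · rintro ⟨i, hi, a, ha, rfl, rfl⟩
      lia
    · intro h
      exact ⟨i.toNat, by lia, (a + i / 2).toNat, by lia, by lia, by lia⟩
  · rw [dnT_mem_upperRows]
    simp only [mem_biUnion, mem_union, mem_image, mem_range, dnT_eq_dnT, upT_eq_dnT,
      and_false, exists_false, false_or]
    constructor
    · rintro ⟨i, hi, a, ha, rfl, rfl⟩
      lia
    · intro h
      exact ⟨i.toNat, by lia, (a + (i + 1) / 2).toNat, by lia, by lia, by lia⟩

/-- Peeling off the row `j`, for either parity of `j`: if `j` is odd, `x 0` stands for the position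
just west of the row. -/
theorem mtil_dentedRows_eq_sum {N m j r q : ℕ} {x : Fin (r + 1) → ℤ} {s : Fin q → ℤ}
    (hx : StrictMono x) (hE : ∀ i : Fin r, x i.succ < N - j) (h0 : -((j + 1) / 2 : ℤ) ≤ x 0)
    (hm : r = 0 ∨ j + 1 < m)
    (h : Mtil (dentedRows N m j s) ∅ =
      Mtil (dnStrip j (x 0) (N - j - 1) (univ.image x) ∪ upperRows N m (j + 1)) ∅) :
    Mtil (dentedRows N m j s) ∅ =
      ∑ w ∈ Fintype.piFinset fun i : Fin r => Ico (x i.castSucc) (x i.succ),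
        Mtil (dentedRows N m (j + 1) w) ∅ := by
  rw [h, mtil_dnStrip_eq_sum (isAbove_upperRows N m j) hx fun i => by have := hE i; lia]
  refine sum_congr rfl fun w hw => ?_
  rw [if_pos]
  · simp [dentedRows]
  · intro i
    have h1 := mem_Ico.1 (Fintype.mem_piFinset.1 hw i)
    have h2 : x 0 ≤ x i.castSucc := hx.monotone (Fin.zero_le _)
    have h3 := hE i
    have := i.pos
    rw [upT_mem_upperRows]
    lia

theorem strictMono_of_mem_Ico {r : ℕ} {x : Fin (r + 1) → ℤ} {w : Fin r → ℤ}
    (hw : ∀ a, x a.castSucc ≤ w a ∧ w a < x a.succ) : StrictMono w := by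
  cases r with
  | zero => exact fun a => a.elim0
  | succ r =>
    refine Fin.strictMono_iff_lt_succ.2 fun a => ?_
    exact (hw a.castSucc).2.trans_le (hw a.succ).1

theorem mtil_dentedRows_even_eq_sum {N m i r : ℕ} {s : Fin (r + 1) → ℤ} (hs : StrictMono s)
    (h0 : -(i : ℤ) ≤ s 0) (hE : ∀ a, s a < N - 2 * i) (hi : 2 * i < m)
    (hm : r = 0 ∨ 2 * i + 1 < m) :
    Mtil (dentedRows N m (2 * i) s) ∅ =
      ∑ w ∈ Fintype.piFinset fun a : Fin r => Ico (s a.castSucc) (s a.succ),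
        Mtil (dentedRows N m (2 * i + 1) w) ∅ := by
  refine mtil_dentedRows_eq_sum hs (fun a => by have := hE a.succ; lia) (by lia) hm ?_
  have h0E := hE 0
  have hle : ∀ a, s 0 ≤ s a := fun a => hs.monotone (Fin.zero_le a)
  rw [← upStrip_eq_dnStrip (by simp), ← mtil_upStrip_skip (isAbove_upperRows N m (2 * i)) h0
    (by lia)]
  · congr 1
    apply tri_ext <;> intro b l
    · simp only [dentedRows, mem_sdiff, mem_union, upT_mem_upperRows, upT_mem_upStrip, mem_image,
        mem_univ, true_and, upT_eq_upT]
      grind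
    · simp only [dentedRows, mem_sdiff, mem_union, dnT_mem_upperRows, dnT_mem_upStrip, mem_image,
        mem_univ, true_and, upT_eq_dnT]
      grind
  · intro c hc
    simp only [mem_Ico, mem_image, mem_univ, true_and, not_exists] at hc ⊢
    intro a
    have := hle a
    lia

theorem mtil_dentedRows_odd_eq_sum {N m i r : ℕ} {s : Fin r → ℤ}
    (hs : StrictMono (Fin.cons (-(i + 1 : ℤ)) s : Fin (r + 1) → ℤ))
    (hE : ∀ a, s a < N - 2 * i - 1) (hm : 2 * i + 2 < m) :
    Mtil (dentedRows N m (2 * i + 1) s) ∅ =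
      ∑ w ∈ Fintype.piFinset fun a : Fin r =>
          Ico ((Fin.cons (-(i + 1 : ℤ)) s : Fin (r + 1) → ℤ) a.castSucc)
            ((Fin.cons (-(i + 1 : ℤ)) s : Fin (r + 1) → ℤ) a.succ),
        Mtil (dentedRows N m (2 * i + 2) w) ∅ := by
  refine mtil_dentedRows_eq_sum hs (fun a => by have := hE a; rw [Fin.cons_succ]; lia)
    (by rw [Fin.cons_zero]; lia) (by lia) ?_
  congr 1
  apply tri_ext <;> intro b l
  · simp only [dentedRows, mem_sdiff, mem_union, upT_mem_upperRows, upT_mem_dnStrip, mem_image,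
      mem_univ, true_and, upT_eq_upT, Fin.exists_fin_succ, Fin.cons_zero, Fin.cons_succ]
    grind
  · simp only [dentedRows, mem_sdiff, mem_union, dnT_mem_upperRows, dnT_mem_dnStrip, mem_image,
      mem_univ, true_and, upT_eq_dnT, Fin.cons_zero]
    grind

theorem mtil_dentedRows_even_eq_det {N m i r : ℕ} {s : Fin (r + 1) → ℤ} (hs : StrictMono s)
    (h0 : -(i : ℤ) ≤ s 0) (hE : ∀ a, s a < N - 2 * i) (hi : 2 * i < m)
    (hm : r = 0 ∨ 2 * i + 1 < m)
    (ih : ∀ w : Fin r → ℤ, StrictMono w → (∀ a, -(i : ℤ) ≤ w a) → (∀ a, w a < N - 2 * i - 1) →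
      (Mtil (dentedRows N m (2 * i + 1) w) ∅ : ℤ) =
        (Matrix.of fun a t : Fin r => Ring.choose (w a + (i + 1 + t)) (2 * (t : ℕ) + 1)).det) :
    (Mtil (dentedRows N m (2 * i) s) ∅ : ℤ) =
      (Matrix.of fun a t : Fin (r + 1) => Ring.choose (s a + (i + t)) (2 * (t : ℕ))).det := by
  rw [mtil_dentedRows_even_eq_sum hs h0 hE hi hm, Nat.cast_sum]
  trans ∑ w ∈ Fintype.piFinset fun a : Fin r => Ico (s a.castSucc) (s a.succ),
    (Matrix.of fun a t : Fin r => Ring.choose (w a + (i + 1 + t)) (2 * (t : ℕ) + 1)).det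
  · refine sum_congr rfl fun w hw => ?_
    have hw' := fun a => mem_Ico.1 (Fintype.mem_piFinset.1 hw a)
    refine ih w (strictMono_of_mem_Ico hw') (fun a => ?_) fun a => ?_
    · exact h0.trans ((hs.monotone (Fin.zero_le _)).trans (hw' a).1)
    · have := (hw' a).2
      have := hE a.succ
      lia
  · rw [sum_det_interlacing (fun t u => Ring.choose (u + (i + 1 + t)) (2 * t + 1))
      (fun t u => Ring.choose (u + (i + 1 + t)) (2 * t + 2))
      (fun t a b hab => sum_Ico_choose _ _ hab) hs]
    congr 1
    ext a t
    refine Fin.cases ?_ (fun t => ?_) t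
    · simp
    · simp [mul_add, add_comm, add_left_comm]

theorem mtil_dentedRows_odd_eq_det {N m i r : ℕ} {s : Fin r → ℤ} (hs : StrictMono s)
    (h0 : ∀ a, -(i : ℤ) ≤ s a) (hE : ∀ a, s a < N - 2 * i - 1) (hm : 2 * i + 2 < m)
    (ih : ∀ w : Fin r → ℤ, StrictMono w → (∀ a, -(i + 1 : ℤ) ≤ w a) →
      (∀ a, w a < N - 2 * i - 2) →
      (Mtil (dentedRows N m (2 * i + 2) w) ∅ : ℤ) =
        (Matrix.of fun a t : Fin r => Ring.choose (w a + (i + 1 + t)) (2 * (t : ℕ))).det) :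
    (Mtil (dentedRows N m (2 * i + 1) s) ∅ : ℤ) =
      (Matrix.of fun a t : Fin r => Ring.choose (s a + (i + 1 + t)) (2 * (t : ℕ) + 1)).det := by
  set x : Fin (r + 1) → ℤ := Fin.cons (-(i + 1 : ℤ)) s with hxdef
  have hx : StrictMono x := by
    refine Fin.strictMono_cons.2 ⟨fun a => ?_, hs⟩
    have := h0 a
    lia
  rw [mtil_dentedRows_odd_eq_sum hx hE hm, Nat.cast_sum]
  trans ∑ w ∈ Fintype.piFinset fun a : Fin r => Ico (x a.castSucc) (x a.succ),
    (Matrix.of fun a t : Fin r => Ring.choose (w a + (i + 1 + t)) (2 * (t : ℕ))).det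
  · refine sum_congr rfl fun w hw => ?_
    have hw' := fun a => mem_Ico.1 (Fintype.mem_piFinset.1 hw a)
    refine ih w (strictMono_of_mem_Ico hw') (fun a => ?_) fun a => ?_
    · exact (hx.monotone (Fin.zero_le _)).trans (hw' a).1
    · have h1 := (hw' a).2
      have := hE a
      rw [hxdef, Fin.cons_succ] at h1
      lia
  · rw [sum_det_interlacing (fun t u => Ring.choose (u + (i + 1 + t)) (2 * t))
      (fun t u => Ring.choose (u + (i + 1 + t)) (2 * t + 1))
      (fun t a b hab => sum_Ico_choose _ _ hab) hx, Matrix.det_succ_row_zero, Fin.sum_univ_succ]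
    have hz : ∀ t : ℕ, Ring.choose (-(i + 1 : ℤ) + (i + 1 + t)) (2 * t + 1) = 0 := fun t => by
      rw [neg_add_cancel_left, Ring.choose_natCast, Nat.choose_eq_zero_of_lt (by lia),
        Nat.cast_zero]
    simp only [Matrix.of_apply, hxdef, Fin.cons_zero, Fin.cons_succ, hz, mul_zero, zero_mul,
      sum_const_zero, add_zero, Fin.val_zero, pow_zero, one_mul]
    refine congrArg Matrix.det (Matrix.ext fun a t => ?_)
    simp

theorem mtil_dentedRows_eq_det (N k r : ℕ) : ∀ i, i + r + 1 = k →
    (∀ w : Fin r → ℤ, StrictMono w → (∀ a, -(i : ℤ) ≤ w a) → (∀ a, w a < N - 2 * i - 1) →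
      (Mtil (dentedRows N (2 * k - 1) (2 * i + 1) w) ∅ : ℤ) =
        (Matrix.of fun a t : Fin r => Ring.choose (w a + (i + 1 + t)) (2 * (t : ℕ) + 1)).det) ∧
    ∀ s : Fin (r + 1) → ℤ, StrictMono s → (∀ a, -(i : ℤ) ≤ s a) → (∀ a, s a < N - 2 * i) →
      (Mtil (dentedRows N (2 * k - 1) (2 * i) s) ∅ : ℤ) =
        (Matrix.of fun a t : Fin (r + 1) => Ring.choose (s a + (i + t)) (2 * (t : ℕ))).det := by
  induction r with
  | zero =>
    intro i hi
    refine ⟨fun w _ _ _ => ?_, fun s hs h0 hE => ?_⟩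
    · rw [show 2 * k - 1 = 2 * i + 1 by lia, mtil_dentedRows_of_eq, Matrix.det_fin_zero,
        Nat.cast_one]
    · refine mtil_dentedRows_even_eq_det hs (h0 0) hE (by lia) (Or.inl rfl) fun w _ _ _ => ?_
      rw [show 2 * k - 1 = 2 * i + 1 by lia, mtil_dentedRows_of_eq, Matrix.det_fin_zero,
        Nat.cast_one]
  | succ r ih =>
    intro i hi
    have odd := fun (w : Fin (r + 1) → ℤ) (hw : StrictMono w) (h0 : ∀ a, -(i : ℤ) ≤ w a)
        (hE : ∀ a, w a < N - 2 * i - 1) =>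
      mtil_dentedRows_odd_eq_det (m := 2 * k - 1) hw h0 hE (by lia) fun w' hw' h0' hE' => by
        have := (ih (i + 1) (by lia)).2 w' hw' (fun a => by have := h0' a; lia)
          (fun a => by have := hE' a; lia)
        simpa [mul_add] using this
    exact ⟨odd, fun s hs h0 hE =>
      mtil_dentedRows_even_eq_det hs (h0 0) hE (by lia) (Or.inr (by lia)) odd⟩

theorem factorial_mul_choose_eq_prod (b t : ℕ) :
    ((2 * t).factorial * (b + t).choose (2 * t) : ℤ) =
      ∏ l ∈ range t, ((b + 1) * b - l * (l + 1) : ℤ) := by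
  induction t with
  | zero => simp
  | succ t ih =>
    have h1 := Nat.add_one_mul_choose_eq (b + t) (2 * t + 1)
    have h2 := Nat.choose_succ_right_eq (b + t) (2 * t)
    have h3 : ((b + t).choose (2 * t) * (b + t - 2 * t : ℕ) : ℤ) =
        (b + t).choose (2 * t) * (b - t) := by
      obtain h | h := le_or_gt (2 * t) (b + t)
      · push_cast [h]
        ring
      · simp [Nat.choose_eq_zero_of_lt h]
    zify at h1 h2
    rw [prod_range_succ, ← ih, show 2 * (t + 1) = 2 * t + 1 + 1 by ring, ← add_assoc b t 1,
      Nat.factorial_succ, Nat.factorial_succ]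
    rw [h3] at h2
    push_cast at h1 h2 ⊢
    linear_combination (-((2 * t).factorial * (2 * t + 1) : ℤ)) * h1 +
      ((2 * t).factorial * (b + t + 1) : ℤ) * h2

theorem prod_factorial_mul_det_choose {k : ℕ} (b : Fin k → ℕ) :
    (∏ t : Fin k, ((2 * (t : ℕ)).factorial : ℤ)) *
        (Matrix.of fun i t : Fin k => ((b i + t).choose (2 * (t : ℕ)) : ℤ)).det =
      ∏ i : Fin k, ∏ j ∈ Ioi i, ((b j + 1) * b j - (b i + 1) * b i : ℤ) := by
  have h := Matrix.det_eval_matrixOfPolynomials_eq_det_vandermonde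
    (fun i => ((b i + 1) * b i : ℤ))
    (fun t : Fin k => ∏ l ∈ range t, (Polynomial.X - Polynomial.C (l * (l + 1) : ℤ)))
    (fun t => by rw [Polynomial.natDegree_finsetProd_X_sub_C_eq_card, card_range])
    (fun t => Polynomial.monic_prod_X_sub_C _ _)
  rw [Matrix.det_vandermonde] at h
  rw [h, ← Matrix.det_mul_row]
  congr 1
  ext i t
  simp [Polynomial.eval_prod, factorial_mul_choose_eq_prod]

theorem h2_two_mul (k : ℕ) : H2 (2 * k) = ∏ t : Fin k, (2 * (t : ℕ)).factorial := by
  rw [Fin.prod_univ_eq_prod_range fun t => (2 * t).factorial, H2]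
  symm
  refine prod_bij' (fun t _ => 2 * t) (fun t _ => t / 2) ?_ ?_ ?_ ?_ ?_
  all_goals simp
  all_goals lia

theorem prod_orderEmbOfFin {k : ℕ} {A : Finset ℕ} (hA : A.card = k) (g : ℕ → ℕ → ℚ) :
    ∏ p ∈ A, ∏ q ∈ A.filter (fun q => p < q), g p q =
      ∏ i : Fin k, ∏ j ∈ Ioi i, g (A.orderEmbOfFin hA i) (A.orderEmbOfFin hA j) := by
  have hmap : A = univ.map (A.orderEmbOfFin hA).toEmbedding := by simp
  conv_lhs => rw [hmap]
  rw [prod_map]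
  refine prod_congr rfl fun i _ => ?_
  rw [filter_map, prod_map]
  refine prod_congr ?_ fun _ _ => rfl
  ext j
  simp

/-- **Lemma 2.3, identity (2.7)**: tilings of the quartered hexagon `L_{2k-1,n}`. -/
theorem quartered_hexagon_odd
    (k n : ℕ) (hk : 1 ≤ k) (hkn : k < n)
    (A : Finset ℕ) (hAc : A.card = k) (hAsub : A ⊆ Finset.Icc 1 n) :
    (Mtil (Lreg (2 * k - 1) n A) ∅ : ℚ) =
      1 / (H2 (2 * k) : ℚ) * prodDiff A * prodSum1 A := by
  obtain ⟨r, rfl⟩ : ∃ r, k = r + 1 := ⟨k - 1, by lia⟩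
  set a := A.orderEmbOfFin hAc with ha
  have ha1 : ∀ i, 1 ≤ a i ∧ a i ≤ n := fun i => mem_Icc.1 (hAsub (A.orderEmbOfFin_mem hAc i))
  have hreg : Lreg (2 * (r + 1) - 1) n A =
      dentedRows (n + (r + 1)) (2 * (r + 1) - 1) (2 * 0) fun i => (a i : ℤ) - 1 := by
    rw [lreg_eq_upperRows _ _ _ (by lia), dentedRows, upDents,
      show (2 * (r + 1) - 1 + 1) / 2 = r + 1 by lia]
    congr 1
    conv_lhs => rw [← A.image_orderEmbOfFin_univ hAc, image_image]
    rfl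
  have hdet := (mtil_dentedRows_eq_det (n + (r + 1)) (r + 1) r 0 (by lia)).2
    (fun i => (a i : ℤ) - 1) (fun i j hij => by have := a.strictMono hij; simp only; lia)
    (fun i => by have := ha1 i; lia) (fun i => by have := ha1 i; push_cast; lia)
  have hchoose := prod_factorial_mul_det_choose fun i => a i - 1
  have hentry : (Matrix.of fun i t : Fin (r + 1) =>
      Ring.choose ((a i : ℤ) - 1 + ((0 : ℕ) + t)) (2 * (t : ℕ))) =
      Matrix.of fun i t : Fin (r + 1) => ((a i - 1 + t).choose (2 * (t : ℕ)) : ℤ) := by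
    ext i t
    have h := (ha1 i).1
    rw [Matrix.of_apply, Matrix.of_apply, ← Ring.choose_natCast]
    push_cast [h]
    rw [zero_add]
  rw [← hreg, hentry] at hdet
  rw [← hdet] at hchoose
  have hH : (H2 (2 * (r + 1)) : ℚ) ≠ 0 := by
    rw [h2_two_mul]
    exact_mod_cast prod_ne_zero_iff.2 fun t _ => Nat.factorial_ne_zero _
  have hprod : prodDiff A * prodSum1 A =
      ∏ i, ∏ j ∈ Ioi i, (((a j : ℚ) - a i) * ((a j : ℚ) + a i - 1)) := by
    rw [prodDiff, prodSum1, prod_orderEmbOfFin hAc fun p q => (q : ℚ) - p,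
      prod_orderEmbOfFin hAc fun p q => (q : ℚ) + p - 1]
    simp only [prod_mul_distrib, ha]
  rw [mul_assoc, hprod, one_div, eq_inv_mul_iff_mul_eq₀ hH, h2_two_mul]
  have hcast := congrArg (Int.cast (R := ℚ)) hchoose
  push_cast at hcast ⊢
  rw [hcast]
  refine prod_congr rfl fun i _ => prod_congr rfl fun j _ => ?_
  push_cast [(ha1 i).1, (ha1 j).1]
  ring
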